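/- arXiv:0804.3156 — 2 statements merged into one kernel-verified Lean document; each statement's English description precedes it below -/
import Mathlib

section
/- Let a < b be real numbers, let ρ : [a,b] → ℝ be continuous, and suppose I, J : [a,b] × [a,b] → ℝ both satisfy: (A) additivity, F(x,y) + F(y,z) = F(x,z) for all x, y, z ∈ [a,b], and (B) the asymptotic property, lim_{h→0} (F(x, x+h) − ρ(x)·h)/h = 0 for every x ∈ [a,b] (the limit taken over h with x+h ∈ [a,b]). Then I = J, i.e., I(x,y) = J(x,y) for all x, y ∈ [a,b]. -/
open Filter Topology

/-- An additive two-variable function with density `ρ x` at `x` has, for any fixed base point `c`,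
derivative `ρ x` at `x` in its second argument. -/
lemma hasDerivWithinAt_of_additive {s : Set ℝ} {F : ℝ → ℝ → ℝ} {c x r : ℝ}
    (hc : c ∈ s) (hx : x ∈ s)
    (hadd : ∀ x ∈ s, ∀ y ∈ s, ∀ z ∈ s, F x y + F y z = F x z)
    (hasymp : Tendsto (fun h : ℝ => (F x (x + h) - r * h) / h)
      (𝓝[{h : ℝ | x + h ∈ s ∧ h ≠ 0}] 0) (𝓝 0)) :
    HasDerivWithinAt (F c) r s x := by
  rw [hasDerivWithinAt_iff_tendsto_slope]
  have hshift : Tendsto (fun y : ℝ => y - x) (𝓝[s \ {x}] x)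
      (𝓝[{h : ℝ | x + h ∈ s ∧ h ≠ 0}] 0) := by
    refine tendsto_nhdsWithin_iff.2 ⟨?_, ?_⟩
    · have hcont : ContinuousAt (fun y : ℝ => y - x) x := by fun_prop
      simpa [ContinuousAt] using hcont.tendsto.mono_left nhdsWithin_le_nhds
    · filter_upwards [self_mem_nhdsWithin] with y hy
      exact ⟨by simpa using hy.1, sub_ne_zero.2 hy.2⟩
  have hlim := (hasymp.comp hshift).add_const r
  rw [zero_add] at hlim
  refine hlim.congr' ?_
  filter_upwards [self_mem_nhdsWithin] with y hy
  have hne : y - x ≠ 0 := sub_ne_zero.2 hy.2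
  have hF := hadd c hc x hx y hy.1
  simp only [Function.comp_apply, slope_def_field, add_sub_cancel, ← hF]
  field_simp
  ring

/-- **Uniqueness.** If `I` and `J` both satisfy additivity (A) and the asymptotic property
(B) with the same continuous density `ρ` on `[a,b]`, then `I = J` on `[a,b] × [a,b]`. -/
theorem integral_function_unique (a b : ℝ) (hab : a < b) (ρ : ℝ → ℝ) (I J : ℝ → ℝ → ℝ)
    (hρ : ContinuousOn ρ (Set.Icc a b))
    (hI_add : ∀ x ∈ Set.Icc a b, ∀ y ∈ Set.Icc a b, ∀ z ∈ Set.Icc a b,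
      I x y + I y z = I x z)
    (hI_asymp : ∀ x ∈ Set.Icc a b,
      Tendsto (fun h : ℝ => (I x (x + h) - ρ x * h) / h)
        (𝓝[{h : ℝ | x + h ∈ Set.Icc a b ∧ h ≠ 0}] 0) (𝓝 0))
    (hJ_add : ∀ x ∈ Set.Icc a b, ∀ y ∈ Set.Icc a b, ∀ z ∈ Set.Icc a b,
      J x y + J y z = J x z)
    (hJ_asymp : ∀ x ∈ Set.Icc a b,
      Tendsto (fun h : ℝ => (J x (x + h) - ρ x * h) / h)
        (𝓝[{h : ℝ | x + h ∈ Set.Icc a b ∧ h ≠ 0}] 0) (𝓝 0)) :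
    ∀ x ∈ Set.Icc a b, ∀ y ∈ Set.Icc a b, I x y = J x y := by
  intro x hx y hy
  have hderiv : ∀ t ∈ Set.Icc a b,
      HasDerivWithinAt (fun t => I x t - J x t) 0 (Set.Icc a b) t := fun t ht => by
    simpa using (hasDerivWithinAt_of_additive hx ht hI_add (hI_asymp t ht)).fun_sub
      (hasDerivWithinAt_of_additive hx ht hJ_add (hJ_asymp t ht))
  have hconst := (convex_Icc a b).norm_image_sub_le_of_norm_hasDerivWithin_le
    (C := 0) hderiv (by simp) hx hy
  rw [zero_mul, norm_le_zero_iff] at hconst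
  linarith [hI_add x hx x hx x hx, hJ_add x hx x hx x hx]
end

section
/- Let a < b be real numbers, let f ∈ C¹[a,b] (continuously differentiable on [a,b]), and let L : [a,b] × [a,b] → ℝ satisfy: (a) L(x,y) + L(y,z) = L(x,z) for all x, y, z ∈ [a,b], and (b) for every x ∈ [a,b], L(x, x+h) = sign(h)·D(x, x+h) + o(h) as h → 0, where D(x, x+h) = √(h² + (f(x+h) − f(x))²) is the Euclidean distance between the points (x, f(x)) and (x+h, f(x+h)); precisely, lim_{h→0} (L(x, x+h) − sign(h)·√(h² + (f(x+h) − f(x))²))/h = 0 (the limit taken over h with x+h ∈ [a,b]). Then L(a,b) = ∫_a^b √(1 + f′(x)²) dx. -/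
open Filter Topology

/-- The signed chord length divided by the increment is the length of the direction vector
`(1, slope)`. -/
theorem sign_mul_sqrt_div_eq_sqrt_one_add_slope_sq {f : ℝ → ℝ} {x y : ℝ} (hxy : y ≠ x) :
    Real.sign (y - x) * Real.sqrt ((y - x) ^ 2 + (f y - f x) ^ 2) / (y - x) =
      Real.sqrt (1 + slope f x y ^ 2) := by
  have hne : y - x ≠ 0 := sub_ne_zero.mpr hxy
  have hfac : (y - x) ^ 2 + (f y - f x) ^ 2 = (y - x) ^ 2 * (1 + slope f x y ^ 2) := by
    rw [slope_def_field]
    field_simp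
  rw [hfac, Real.sqrt_mul (sq_nonneg _), Real.sqrt_sq_eq_abs, ← mul_assoc]
  rcases lt_or_gt_of_ne hne with h | h
  · rw [Real.sign_of_neg h, abs_of_neg h]
    field_simp
  · rw [Real.sign_of_pos h, abs_of_pos h]
    field_simp

/-- If `F y - F x` is the signed chord length of the graph of `f` up to `o(y - x)` within `s`, then
`F` has derivative `√(1 + f'²)` at `x` within `s`. -/
theorem hasDerivWithinAt_sqrt_one_add_sq_of_tendsto_chord {f F : ℝ → ℝ} {s : Set ℝ} {x f' : ℝ}
    (hf : HasDerivWithinAt f f' s x)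
    (hF : Tendsto
      (fun h : ℝ =>
        (F (x + h) - F x - Real.sign h * Real.sqrt (h ^ 2 + (f (x + h) - f x) ^ 2)) / h)
      (𝓝[{h : ℝ | x + h ∈ s ∧ h ≠ 0}] 0) (𝓝 0)) :
    HasDerivWithinAt F (Real.sqrt (1 + f' ^ 2)) s x := by
  rw [hasDerivWithinAt_iff_tendsto_slope] at hf ⊢
  have hshift : Tendsto (fun y : ℝ => y - x) (𝓝[s \ {x}] x)
      (𝓝[{h : ℝ | x + h ∈ s ∧ h ≠ 0}] 0) := by
    refine tendsto_nhdsWithin_iff.mpr ⟨?_, ?_⟩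
    · have hc : Tendsto (fun y : ℝ => y - x) (𝓝 x) (𝓝 (x - x)) :=
        (continuous_id.sub continuous_const).tendsto x
      rw [sub_self] at hc
      exact hc.mono_left nhdsWithin_le_nhds
    · filter_upwards [self_mem_nhdsWithin] with y hy
      exact ⟨by simpa using hy.1, sub_ne_zero.mpr hy.2⟩
  have hsqrt : Tendsto (fun y => Real.sqrt (1 + slope f x y ^ 2)) (𝓝[s \ {x}] x)
      (𝓝 (Real.sqrt (1 + f' ^ 2))) := ((hf.pow 2).const_add 1).sqrt
  have hsum := (hF.comp hshift).add hsqrt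
  rw [zero_add] at hsum
  refine hsum.congr' ?_
  filter_upwards [self_mem_nhdsWithin] with y hy
  rw [← sign_mul_sqrt_div_eq_sqrt_one_add_slope_sq hy.2, slope_def_field]
  simp only [Function.comp_apply, add_sub_cancel]
  ring

/-- **Arclength.** If `f ∈ C¹[a,b]` and `L : [a,b] × [a,b] → ℝ` is additive with
`L(x, x+h) = sign(h)·D(x, x+h) + o(h)` as `h → 0`, where
`D(x, x+h) = √(h² + (f(x+h) - f(x))²)`, then `L(a,b) = ∫_a^b √(1 + f'(x)²) dx`. -/
theorem arclength_formula (a b : ℝ) (hab : a < b) (f : ℝ → ℝ) (L : ℝ → ℝ → ℝ)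
    (hf : ContDiffOn ℝ 1 f (Set.Icc a b))
    (hL_add : ∀ x ∈ Set.Icc a b, ∀ y ∈ Set.Icc a b, ∀ z ∈ Set.Icc a b,
      L x y + L y z = L x z)
    (hL_asymp : ∀ x ∈ Set.Icc a b,
      Tendsto
        (fun h : ℝ =>
          (L x (x + h) - Real.sign h * Real.sqrt (h ^ 2 + (f (x + h) - f x) ^ 2)) / h)
        (𝓝[{h : ℝ | x + h ∈ Set.Icc a b ∧ h ≠ 0}] 0) (𝓝 0)) :
    L a b = ∫ x in a..b, Real.sqrt (1 + derivWithin f (Set.Icc a b) x ^ 2) := by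
  have haI : a ∈ Set.Icc a b := Set.left_mem_Icc.mpr hab.le
  have hderiv : ∀ x ∈ Set.Icc a b, HasDerivWithinAt (L a)
      (Real.sqrt (1 + derivWithin f (Set.Icc a b) x ^ 2)) (Set.Icc a b) x := by
    intro x hx
    refine hasDerivWithinAt_sqrt_one_add_sq_of_tendsto_chord
      ((hf.differentiableOn one_ne_zero) x hx).hasDerivWithinAt ((hL_asymp x hx).congr' ?_)
    filter_upwards [self_mem_nhdsWithin] with h hh
    rw [← hL_add a haI x hx (x + h) hh.1, add_sub_cancel_left]
  have hcont : ContinuousOn (fun x => Real.sqrt (1 + derivWithin f (Set.Icc a b) x ^ 2))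
      (Set.Icc a b) :=
    (continuousOn_const.add
      ((hf.continuousOn_derivWithin (uniqueDiffOn_Icc hab) le_rfl).pow 2)).sqrt
  have haa : L a a = 0 := by linarith [hL_add a haI a haI a haI]
  rw [intervalIntegral.integral_eq_sub_of_hasDerivAt_of_le hab.le
    (fun x hx => (hderiv x hx).continuousWithinAt)
    (fun x hx => (hderiv x (Set.Ioo_subset_Icc_self hx)).hasDerivAt (Icc_mem_nhds hx.1 hx.2))
    (hcont.intervalIntegrable_of_Icc hab.le), haa, sub_zero]
end
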